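/- Let M ≥ 2, u ∈ ℝ³ and u_th > 0, and let f : ℝ³ → ℝ be a finite Hermite expansion f(v) = Σ_{|α| ≤ M} f_α 𝓗_{u_th,α}(ξ) with ξ = (v − u)/√u_th, where u and u_th coincide with the macroscopic velocity and thermal velocity of f and the density of f is positive. Then the pressure tensor p_{ij} = ∫_{ℝ³} (v_i − u_i)(v_j − u_j) f(v) dv satisfies, for all i, j ∈ {1,2,3}, p_{ij} − (1/3) δ_{ij} Σ_{d=1}^{3} p_{dd} = (1 + δ_{ij}) f_{e_i + e_j}, where δ_{ij} is the Kronecker delta. -/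

import Mathlib

open MeasureTheory Real

/-- Probabilists' Hermite polynomial `He_n(x) = (-1)^n e^{x²/2} dⁿ/dxⁿ e^{-x²/2}`,
extended by `0` for negative indices. -/
noncomputable def He (n : ℤ) (x : ℝ) : ℝ :=
  if n < 0 then 0
  else (-1 : ℝ) ^ n.toNat * Real.exp (x ^ 2 / 2) *
    iteratedDeriv n.toNat (fun y => Real.exp (-(y ^ 2) / 2)) x

/-- Hermite basis function `𝓗_{uth,α}(ξ)`; it vanishes whenever a component of
the multi-index `α` is negative. -/
noncomputable def hermiteH (uth : ℝ) (α : Fin 3 → ℤ) (ξ : Fin 3 → ℝ) : ℝ :=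
  ∏ d : Fin 3, (Real.sqrt (2 * π))⁻¹ * uth ^ ((-(α d : ℝ) - 1) / 2) *
    He (α d) (ξ d) * Real.exp (-(ξ d) ^ 2 / 2)

/-- The set of multi-indices `α ∈ ℕ³` with `|α| ≤ M`. -/
def multiIndices (M : ℕ) : Finset (Fin 3 → ℕ) :=
  (Finset.Icc 0 fun _ => M).filter fun α => ∑ d, α d ≤ M

open Polynomial in
/-- `He` at a natural index is Mathlib's Hermite polynomial. -/
theorem He_natCast (n : ℕ) (x : ℝ) : He (n : ℤ) x = aeval x (hermite n) := by
  rw [hermite_eq_deriv_gaussian', He, if_neg (by simp), Int.toNat_natCast, iteratedDeriv_eq_iterate]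
  simp only [neg_div]
  ring

/-- A polynomial times the standard Gaussian weight is integrable. -/
theorem integrable_polynomial_mul_exp_neg_sq_div_two (P : Polynomial ℝ) :
    Integrable fun x : ℝ => P.eval x * Real.exp (-x ^ 2 / 2) := by
  induction P using Polynomial.induction_on' with
  | add p q hp hq =>
    simp only [Polynomial.eval_add, add_mul]
    exact hp.add hq
  | monomial n a =>
    have h := integrable_rpow_mul_exp_neg_mul_sq (b := 1 / 2) (by norm_num) (s := n)
      (by linarith [n.cast_nonneg (α := ℝ)])
    convert h.const_mul a using 2 with x
    rw [Polynomial.eval_monomial, Real.rpow_natCast, mul_assoc]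
    ring_nf

/-- The one-dimensional factor of `hermiteH`, in the variable `x = u + √uth ξ`, with `s = √uth`. -/
noncomputable def hermiteFactor (s u : ℝ) (n : ℕ) (x : ℝ) : ℝ :=
  (Real.sqrt (2 * π))⁻¹ * s⁻¹ ^ (n + 1) * He n ((x - u) / s) *
    Real.exp (-((x - u) / s) ^ 2 / 2)

theorem hermiteH_eq_prod_hermiteFactor {uth : ℝ} (huth : 0 < uth) (u : Fin 3 → ℝ)
    (α : Fin 3 → ℕ) (v : Fin 3 → ℝ) :
    hermiteH uth (fun d => (α d : ℤ)) (fun d => (v d - u d) / Real.sqrt uth) =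
      ∏ d, hermiteFactor (Real.sqrt uth) (u d) (α d) (v d) := by
  refine Finset.prod_congr rfl fun d _ => ?_
  have h : uth ^ ((-(((α d : ℕ) : ℤ) : ℝ) - 1) / 2) = (Real.sqrt uth)⁻¹ ^ (α d + 1) := by
    rw [Real.sqrt_eq_rpow, ← Real.rpow_neg huth.le, ← Real.rpow_natCast, ← Real.rpow_mul huth.le]
    congr 1
    push_cast
    ring
  rw [hermiteFactor, h]

theorem integrable_pow_mul_hermiteFactor {s : ℝ} (hs : 0 < s) (u : ℝ) (k n : ℕ) :
    Integrable fun x => (x - u) ^ k * hermiteFactor s u n x := by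
  have h := (((integrable_polynomial_mul_exp_neg_sq_div_two
    (Polynomial.X ^ k * (Polynomial.hermite n).map (Int.castRingHom ℝ))).comp_div
      hs.ne').comp_sub_right u).const_mul ((Real.sqrt (2 * π))⁻¹ * s⁻¹ ^ (n + 1) * s ^ k)
  convert h using 2 with x
  rw [hermiteFactor, He_natCast, Polynomial.eval_mul, Polynomial.eval_pow, Polynomial.eval_X,
    Polynomial.eval_map, Polynomial.aeval_def, algebraMap_int_eq]
  have hx : (x - u) ^ k = s ^ k * ((x - u) / s) ^ k := by
    rw [← mul_pow, mul_div_cancel₀ _ hs.ne']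
  rw [hx]
  ring

theorem hasDerivAt_hermiteFactor (s u : ℝ) (n : ℕ) (x : ℝ) :
    HasDerivAt (hermiteFactor s u n) (-hermiteFactor s u (n + 1) x) x := by
  have hξ : HasDerivAt (fun x => (x - u) / s) (1 / s) x := ((hasDerivAt_id x).sub_const u).div_const s
  have hP := ((Polynomial.hermite n).hasDerivAt_aeval ((x - u) / s)).comp x hξ
  have hE := (((hξ.pow 2).neg).div_const 2).exp
  have h := (hP.const_mul ((Real.sqrt (2 * π))⁻¹ * s⁻¹ ^ (n + 1))).mul hE
  have hfun : hermiteFactor s u n = fun x => (Real.sqrt (2 * π))⁻¹ * s⁻¹ ^ (n + 1) *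
      Polynomial.aeval ((x - u) / s) (Polynomial.hermite n) *
      Real.exp (-((x - u) / s) ^ 2 / 2) := by
    funext y
    rw [hermiteFactor, He_natCast]
  rw [hfun]
  refine h.congr_deriv ?_
  rw [hermiteFactor, He_natCast, Polynomial.hermite_succ]
  simp only [map_sub, map_mul, Polynomial.aeval_X, Function.comp, Pi.neg_apply, Pi.pow_apply]
  push_cast
  ring

/-- Integration by parts lowers both the degree and the order of a moment. -/
theorem integral_pow_mul_hermiteFactor_succ {s : ℝ} (hs : 0 < s) (u : ℝ) (k n : ℕ) :
    ∫ x, (x - u) ^ k * hermiteFactor s u (n + 1) x =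
      k * ∫ x, (x - u) ^ (k - 1) * hermiteFactor s u n x := by
  have hpow (x : ℝ) : HasDerivAt (fun x => (x - u) ^ k) (k * (x - u) ^ (k - 1)) x := by
    exact (((hasDerivAt_id x).sub_const u).pow k).congr_deriv (mul_one _)
  have h := integral_mul_deriv_eq_deriv_mul_of_integrable (fun x _ => hpow x)
    (fun x _ => hasDerivAt_hermiteFactor s u n x)
    (by simpa [Pi.mul_def] using (integrable_pow_mul_hermiteFactor hs u k (n + 1)).neg)
    (by simpa [Pi.mul_def, mul_assoc] using
      (integrable_pow_mul_hermiteFactor hs u (k - 1) n).const_mul (k : ℝ))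
    (integrable_pow_mul_hermiteFactor hs u k n)
  simp only [mul_neg, integral_neg, mul_assoc, integral_const_mul] at h
  exact neg_injective h

theorem integral_hermiteFactor_zero {s : ℝ} (hs : 0 < s) (u : ℝ) :
    ∫ x, hermiteFactor s u 0 x = 1 := by
  have h0 (x : ℝ) : hermiteFactor s u 0 x =
      (Real.sqrt (2 * π))⁻¹ * s⁻¹ * Real.exp (-(1 / 2) * ((x - u) / s) ^ 2) := by
    rw [hermiteFactor, He_natCast, Polynomial.hermite_zero, map_one, map_one, zero_add, pow_one,
      mul_one]
    ring_nf
  simp only [h0]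
  rw [integral_const_mul, integral_sub_right_eq_self (fun x => Real.exp (-(1 / 2) * (x / s) ^ 2)) u,
    Measure.integral_comp_div (fun x => Real.exp (-(1 / 2) * x ^ 2)), integral_gaussian, abs_of_pos hs,
    show π / (1 / 2) = 2 * π by ring, smul_eq_mul]
  have := hs.ne'
  field_simp

theorem integral_pow_succ_mul_hermiteFactor_zero {s : ℝ} (hs : 0 < s) (u : ℝ) (k : ℕ) :
    ∫ x, (x - u) ^ (k + 1) * hermiteFactor s u 0 x =
      s ^ 2 * (k * ∫ x, (x - u) ^ (k - 1) * hermiteFactor s u 0 x) := by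
  rw [← integral_pow_mul_hermiteFactor_succ hs, ← integral_const_mul]
  congr 1
  funext x
  have := hs.ne'
  simp only [hermiteFactor, He_natCast, zero_add, Polynomial.hermite_zero, Polynomial.hermite_one,
    Polynomial.aeval_X, map_one, one_add_one_eq_two, pow_one]
  field_simp
  ring

theorem integral_pow_zero_mul_hermiteFactor {s : ℝ} (hs : 0 < s) (u : ℝ) (n : ℕ) :
    ∫ x, (x - u) ^ 0 * hermiteFactor s u n x = if n = 0 then 1 else 0 := by
  cases n with
  | zero => simpa using integral_hermiteFactor_zero hs u
  | succ n => simpa using integral_pow_mul_hermiteFactor_succ hs u 0 n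

theorem integral_pow_one_mul_hermiteFactor {s : ℝ} (hs : 0 < s) (u : ℝ) (n : ℕ) :
    ∫ x, (x - u) ^ 1 * hermiteFactor s u n x = if n = 1 then 1 else 0 := by
  cases n with
  | zero => simpa using integral_pow_succ_mul_hermiteFactor_zero hs u 0
  | succ n =>
    rw [integral_pow_mul_hermiteFactor_succ hs, integral_pow_zero_mul_hermiteFactor hs]
    simp

theorem integral_pow_two_mul_hermiteFactor {s : ℝ} (hs : 0 < s) (u : ℝ) (n : ℕ) :
    ∫ x, (x - u) ^ 2 * hermiteFactor s u n x =
      s ^ 2 * (if n = 0 then 1 else 0) + 2 * if n = 2 then 1 else 0 := by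
  cases n with
  | zero =>
    rw [integral_pow_succ_mul_hermiteFactor_zero hs, integral_pow_zero_mul_hermiteFactor hs]
    simp
  | succ n =>
    rw [integral_pow_mul_hermiteFactor_succ hs, integral_pow_one_mul_hermiteFactor hs]
    simp

section Expansion

variable {M : ℕ} {u : Fin 3 → ℝ} {uth : ℝ} {c : (Fin 3 → ℕ) → ℝ} {f : (Fin 3 → ℝ) → ℝ}

theorem monomial_mul_hermite_expansion (huth : 0 < uth)
    (hf : ∀ v, f v = ∑ α ∈ multiIndices M, c α *
      hermiteH uth (fun d => (α d : ℤ)) (fun d => (v d - u d) / Real.sqrt uth))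
    (κ : Fin 3 → ℕ) (v : Fin 3 → ℝ) :
    (∏ d, (v d - u d) ^ κ d) * f v = ∑ α ∈ multiIndices M, c α *
      ∏ d, (v d - u d) ^ κ d * hermiteFactor (Real.sqrt uth) (u d) (α d) (v d) := by
  rw [hf, Finset.mul_sum]
  refine Finset.sum_congr rfl fun α _ => ?_
  rw [hermiteH_eq_prod_hermiteFactor huth, Finset.prod_mul_distrib]
  ring

theorem integrable_monomial_mul_hermite_expansion (huth : 0 < uth)
    (hf : ∀ v, f v = ∑ α ∈ multiIndices M, c α *
      hermiteH uth (fun d => (α d : ℤ)) (fun d => (v d - u d) / Real.sqrt uth))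
    (κ : Fin 3 → ℕ) :
    Integrable fun v => (∏ d, (v d - u d) ^ κ d) * f v := by
  simp only [monomial_mul_hermite_expansion huth hf]
  exact integrable_finsetSum _ fun α _ => (Integrable.fintype_prod fun d =>
    integrable_pow_mul_hermiteFactor (Real.sqrt_pos.2 huth) (u d) (κ d) (α d)).const_mul _

theorem integral_monomial_mul_hermite_expansion (huth : 0 < uth)
    (hf : ∀ v, f v = ∑ α ∈ multiIndices M, c α *
      hermiteH uth (fun d => (α d : ℤ)) (fun d => (v d - u d) / Real.sqrt uth))
    (κ : Fin 3 → ℕ) :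
    ∫ v, (∏ d, (v d - u d) ^ κ d) * f v = ∑ α ∈ multiIndices M, c α *
      ∏ d, ∫ x, (x - u d) ^ κ d * hermiteFactor (Real.sqrt uth) (u d) (α d) x := by
  simp only [monomial_mul_hermite_expansion huth hf]
  have hint (α : Fin 3 → ℕ) : Integrable fun v : Fin 3 → ℝ => c α *
      ∏ d, (v d - u d) ^ κ d * hermiteFactor (Real.sqrt uth) (u d) (α d) (v d) :=
    (Integrable.fintype_prod fun d =>
      integrable_pow_mul_hermiteFactor (Real.sqrt_pos.2 huth) (u d) (κ d) (α d)).const_mul _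
  rw [integral_finsetSum _ fun α _ => hint α]
  refine Finset.sum_congr rfl fun α _ => ?_
  rw [integral_const_mul, ← integral_fintype_prod_volume_eq_prod (fun d x =>
    (x - u d) ^ κ d * hermiteFactor (Real.sqrt uth) (u d) (α d) x)]

/-- A moment of multidegree at most one in each variable picks out a single coefficient. -/
theorem integral_squarefree_monomial_mul_hermite_expansion (huth : 0 < uth)
    (hf : ∀ v, f v = ∑ α ∈ multiIndices M, c α *
      hermiteH uth (fun d => (α d : ℤ)) (fun d => (v d - u d) / Real.sqrt uth))
    {κ : Fin 3 → ℕ} (hκ : ∀ d, κ d ≤ 1) (hκM : κ ∈ multiIndices M) :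
    ∫ v, (∏ d, (v d - u d) ^ κ d) * f v = c κ := by
  rw [integral_monomial_mul_hermite_expansion huth hf]
  have h (α : Fin 3 → ℕ) (d : Fin 3) :
      ∫ x, (x - u d) ^ κ d * hermiteFactor (Real.sqrt uth) (u d) (α d) x =
        if α d = κ d then 1 else 0 := by
    have := Real.sqrt_pos.2 huth
    obtain hd | hd := Nat.le_one_iff_eq_zero_or_eq_one.1 (hκ d)
    · rw [hd, integral_pow_zero_mul_hermiteFactor this]
    · rw [hd, integral_pow_one_mul_hermiteFactor this]
  have hprod (α : Fin 3 → ℕ) : ∏ d, (if α d = κ d then (1 : ℝ) else 0) =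
      if α = κ then 1 else 0 := by
    simp [Finset.prod_ite_zero, funext_iff]
  simp only [h, hprod, mul_ite, mul_one, mul_zero, Finset.sum_ite_eq', if_pos hκM]

theorem integral_square_mul_hermite_expansion (hM : 2 ≤ M) (huth : 0 < uth)
    (hf : ∀ v, f v = ∑ α ∈ multiIndices M, c α *
      hermiteH uth (fun d => (α d : ℤ)) (fun d => (v d - u d) / Real.sqrt uth))
    (i : Fin 3) :
    ∫ v, (∏ d, (v d - u d) ^ (Pi.single i 2 : Fin 3 → ℕ) d) * f v =
      uth * c 0 + 2 * c (Pi.single i 2) := by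
  rw [integral_monomial_mul_hermite_expansion huth hf]
  have hs := Real.sqrt_pos.2 huth
  have h (α : Fin 3 → ℕ) :
      ∏ d, ∫ x, (x - u d) ^ (Pi.single i 2 : Fin 3 → ℕ) d *
        hermiteFactor (Real.sqrt uth) (u d) (α d) x =
        uth * (if α = 0 then 1 else 0) + 2 * if α = Pi.single i 2 then 1 else 0 := by
    have h0 : (α = 0) ↔ α i = 0 ∧ ∀ d ∈ Finset.univ.erase i, α d = 0 := by
      simp only [funext_iff, Finset.mem_erase, Finset.mem_univ, and_true, Pi.zero_apply]
      grind
    have h2 : (α = Pi.single i 2) ↔ α i = 2 ∧ ∀ d ∈ Finset.univ.erase i, α d = 0 := by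
      simp only [funext_iff, Finset.mem_erase, Finset.mem_univ, and_true, Pi.single_apply]
      grind
    have hne : ∀ d ∈ Finset.univ.erase i,
        ∫ x, (x - u d) ^ (Pi.single i 2 : Fin 3 → ℕ) d *
          hermiteFactor (Real.sqrt uth) (u d) (α d) x = if α d = 0 then 1 else 0 := by
      intro d hd
      rw [Pi.single_eq_of_ne (Finset.ne_of_mem_erase hd), integral_pow_zero_mul_hermiteFactor hs]
    rw [← Finset.mul_prod_erase _ _ (Finset.mem_univ i), Finset.prod_congr rfl hne,
      Finset.prod_ite_zero, Finset.prod_const_one, Pi.single_eq_same,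
      integral_pow_two_mul_hermiteFactor hs, Real.sq_sqrt huth.le]
    simp only [h0, h2, ite_and]
    split_ifs <;> simp
  have hmem0 : (0 : Fin 3 → ℕ) ∈ multiIndices M := by simp [multiIndices]
  have hmem2 : (Pi.single i 2 : Fin 3 → ℕ) ∈ multiIndices M := by
    simp only [multiIndices, Finset.mem_filter, Finset.mem_Icc, Pi.le_def, Pi.single_apply]
    refine ⟨⟨fun _ => Nat.zero_le _, fun d => ?_⟩, by simpa using hM⟩
    split_ifs <;> omega
  simp only [h, mul_add, Finset.sum_add_distrib, mul_ite, mul_one, mul_zero, Finset.sum_ite_eq',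
    if_pos hmem0, if_pos hmem2]
  ring

end Expansion

/-- The deviatoric pressure tensor of a finite Hermite expansion (centered at
its own macroscopic velocity and thermal velocity) in terms of the
coefficients: `p_{ij} - (1/3) δ_{ij} ∑_d p_{dd} = (1 + δ_{ij}) f_{e_i+e_j}`. -/
theorem pressure_tensor_of_hermite_expansion
    (M : ℕ) (hM : 2 ≤ M)
    (u : Fin 3 → ℝ) (uth : ℝ) (huth : 0 < uth)
    (c : (Fin 3 → ℕ) → ℝ) (f : (Fin 3 → ℝ) → ℝ)
    -- `f` is the finite Hermite expansion with coefficients `c α = f_α`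
    (hf : ∀ v, f v = ∑ α ∈ multiIndices M, c α *
      hermiteH uth (fun d => (α d : ℤ)) (fun d => (v d - u d) / Real.sqrt uth))
    (ρ : ℝ) (hρpos : 0 < ρ)
    -- `ρ, u, uth` are the density, macroscopic velocity and thermal velocity of `f`
    (hρ : ρ = ∫ v, f v)
    (hu : ∀ d, ρ * u d = ∫ v, v d * f v)
    (huth : ρ * (∑ d, u d ^ 2) + 3 * ρ * uth = ∫ v, (∑ d, v d ^ 2) * f v)
    -- the pressure tensor
    (p : Fin 3 → Fin 3 → ℝ)
    (hp : ∀ i j, p i j = ∫ v, (v i - u i) * (v j - u j) * f v) :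
    ∀ i j : Fin 3,
      p i j - (1 / 3) * (if i = j then (1 : ℝ) else 0) * (∑ d, p d d) =
        (1 + if i = j then (1 : ℝ) else 0) *
          c fun k => (if k = i then 1 else 0) + (if k = j then 1 else 0) := by
  rename_i huth_pos
  have hc0 : ρ = c 0 := by
    rw [hρ, ← integral_squarefree_monomial_mul_hermite_expansion huth_pos hf (κ := 0) (by simp)
      (by simp [multiIndices])]
    simp
  have hone (v : Fin 3 → ℝ) : ∏ d, (v d - u d) ^ (0 : Fin 3 → ℕ) d = 1 := by simp
  have hlin (i : Fin 3) (v : Fin 3 → ℝ) :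
      ∏ d, (v d - u d) ^ (Pi.single i 1 : Fin 3 → ℕ) d = v i - u i := by
    simp [Pi.single_apply, pow_ite]
  have hsq (i : Fin 3) (v : Fin 3 → ℝ) :
      ∏ d, (v d - u d) ^ (Pi.single i 2 : Fin 3 → ℕ) d = (v i - u i) * (v i - u i) := by
    simp [Pi.single_apply, pow_ite, sq]
  have hint0 : Integrable f := by
    simpa [hone] using integrable_monomial_mul_hermite_expansion huth_pos hf 0
  have hint1 (i : Fin 3) : Integrable fun v => (v i - u i) * f v := by
    simpa only [hlin] using integrable_monomial_mul_hermite_expansion huth_pos hf (Pi.single i 1)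
  have hint2 (i : Fin 3) : Integrable fun v => (v i - u i) * (v i - u i) * f v := by
    simpa only [hsq] using integrable_monomial_mul_hermite_expansion huth_pos hf (Pi.single i 2)
  have hcentered (i : Fin 3) : ∫ v, (v i - u i) * f v = 0 := by
    have h : ∫ v, v i * f v = ∫ v, ((v i - u i) * f v + u i * f v) := by
      congr 1
      funext v
      ring
    rw [integral_add (hint1 i) (hint0.const_mul _), integral_const_mul, ← hu, ← hρ] at h
    linarith
  have htrace : ∑ d, p d d = 3 * ρ * uth := by
    have h : ∫ v, (∑ d, v d ^ 2) * f v = ∫ v, ∑ d, ((v d - u d) * (v d - u d) * f v +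
        2 * u d * ((v d - u d) * f v) + u d ^ 2 * f v) := by
      congr 1
      funext v
      rw [Finset.sum_mul]
      refine Finset.sum_congr rfl fun d _ => ?_
      ring
    have hint21 (d : Fin 3) : Integrable fun v => (v d - u d) * (v d - u d) * f v +
        2 * u d * ((v d - u d) * f v) :=
      (hint2 d).add ((hint1 d).const_mul _)
    have hd (d : Fin 3) : ∫ v, ((v d - u d) * (v d - u d) * f v +
        2 * u d * ((v d - u d) * f v) + u d ^ 2 * f v) = p d d + u d ^ 2 * ρ := by
      rw [integral_add (hint21 d) (hint0.const_mul _), integral_add (hint2 d)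
        ((hint1 d).const_mul _), integral_const_mul, integral_const_mul, hcentered, ← hρ, ← hp, mul_zero, add_zero]
    have hint210 (d : Fin 3) : Integrable fun v => (v d - u d) * (v d - u d) * f v +
        2 * u d * ((v d - u d) * f v) + u d ^ 2 * f v :=
      (hint21 d).add (hint0.const_mul _)
    rw [integral_finsetSum _ fun d _ => hint210 d] at h
    simp only [hd, Finset.sum_add_distrib, ← Finset.sum_mul] at h
    linarith
  intro i j
  by_cases hij : i = j
  · subst hij
    have hκ : (fun k => (if k = i then 1 else 0) + (if k = i then 1 else 0)) =
        (Pi.single i 2 : Fin 3 → ℕ) := by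
      funext k
      rw [Pi.single_apply]
      split_ifs <;> rfl
    have h := integral_square_mul_hermite_expansion hM huth_pos hf i
    simp only [hsq, ← hp, ← hc0] at h
    rw [hκ, htrace, h, if_pos rfl]
    ring
  · have hprod (v : Fin 3 → ℝ) : (v i - u i) * (v j - u j) =
        ∏ d, (v d - u d) ^ ((if d = i then 1 else 0) + (if d = j then 1 else 0)) := by
      simp only [pow_add, Finset.prod_mul_distrib]
      simp [pow_ite]
    have hle (d : Fin 3) : (if d = i then 1 else 0) + (if d = j then 1 else 0) ≤ 1 := by
      grind
    rw [hp]
    simp only [hprod, if_neg hij]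
    rw [integral_squarefree_monomial_mul_hermite_expansion huth_pos hf hle]
    · ring
    · simp only [multiIndices, Finset.mem_filter, Finset.mem_Icc, Pi.le_def]
      refine ⟨⟨fun _ => Nat.zero_le _, fun d => (hle d).trans (by omega)⟩, ?_⟩
      simpa [Finset.sum_add_distrib] using hM
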